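/- Fix a group homomorphism E:(P,+)→(ℝ_{>0},×) with E(α_i)>1 for every simple root α_i. For λ∈P^+ define the evaluated Weyl character χ_λ(E):=(Σ_{w∈W}(−1)^{ℓ(w)}E(w(λ+ρ)−ρ))/∏_{α∈R^+}(1−E(α)^{−1}) and the evaluated layer sum w_λ(E):=Σ_{γ∈P(λ)}E(γ), where P(λ) is the (finite) set of γ∈P whose dominant W-conjugate is ≤λ in the dominance order. Then for every sequence (λ^{(k)})_{k≥0} of dominant weights with ⟨λ^{(k)},α_i^∨⟩→+∞ for each simple root α_i, one has lim_{k→∞} E(λ^{(k)})^{−1}χ_{λ^{(k)}}(E) = ∏_{α∈R^+}(1−E(α)^{−1})^{−1} and lim_{k→∞} E(λ^{(k)})^{−1}w_{λ^{(k)}}(E) = ∏_{α∈S}(1−E(α)^{−1})^{−1}. -/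

import Mathlib

open scoped RealInnerProductSpace

attribute [local instance] Classical.propDecidable

namespace AtomicPaper

/-- Data of a finite crystallographic root system spanning a real inner product space `E`:
the positive roots `RPos`, the simple roots `Simple ⊆ RPos`, which are linearly independent,
every positive root being a nonnegative integer combination of simple roots, with the
crystallographic integrality condition, and the roots spanning `E`. -/
structure RootSystemData (E : Type*) [NormedAddCommGroup E] [InnerProductSpace ℝ E] where
  RPos : Finset E
  Simple : Finset E
  simple_subset : Simple ⊆ RPos
  ne_zero : ∀ α ∈ RPos, α ≠ 0
  simple_indep : LinearIndependent ℝ (fun α : Simple => (α : E))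
  pos_nat_comb : ∀ α ∈ RPos, ∃ c : E → ℕ, α = ∑ β ∈ Simple, (c β : ℝ) • β
  crystallographic : ∀ α ∈ RPos, ∀ β ∈ RPos, ∃ m : ℤ, 2 * ⟪α, β⟫ / ⟪β, β⟫ = (m : ℝ)
  span_top : Submodule.span ℝ (RPos : Set E) = ⊤
  refl_closed : ∀ α ∈ RPos, ∀ β ∈ RPos,
    (β - (2 * ⟪β, α⟫ / ⟪α, α⟫) • α) ∈ RPos ∨ -(β - (2 * ⟪β, α⟫ / ⟪α, α⟫) • α) ∈ RPos

namespace RootSystemData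

variable {E : Type*} [NormedAddCommGroup E] [InnerProductSpace ℝ E] (rs : RootSystemData E)

/-- The coroot pairing `⟨x, α^∨⟩ = 2 ⟪x, α⟫ / ⟪α, α⟫`. -/
noncomputable def pairCo (α x : E) : ℝ := 2 * ⟪x, α⟫ / ⟪α, α⟫

/-- The weight lattice `P = {x ∈ E : ⟨x, α^∨⟩ ∈ ℤ for all roots α}`. -/
def wtLattice : Set E := {x | ∀ α ∈ rs.RPos, ∃ m : ℤ, pairCo α x = (m : ℝ)}

/-- The dominant weights `P⁺`. -/
def Pplus : Set E := {x | x ∈ rs.wtLattice ∧ ∀ α ∈ rs.Simple, 0 ≤ pairCo α x}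

/-- Dominance order: `ν ≤ μ` iff `μ - ν` is a nonnegative integer combination of simple
roots. -/
def domLE (ν μ : E) : Prop := ∃ c : E → ℕ, μ - ν = ∑ α ∈ rs.Simple, (c α : ℝ) • α

/-- `ρ`, the half-sum of the positive roots. -/
noncomputable def rho : E := (2 : ℝ)⁻¹ • ∑ α ∈ rs.RPos, α

/-- `⟨β, ρ^∨⟩`: the number of simple roots (with multiplicity) in the decomposition
`β = Σ_i c_i α_i`, i.e. `Σ_i c_i` (the coefficients are unique since the simple roots are
linearly independent); `0` if `β` is not such a combination. -/
noncomputable def htRho (β : E) : ℕ :=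
  if h : ∃ c : E → ℕ, β = ∑ α ∈ rs.Simple, (c α : ℝ) • α then ∑ α ∈ rs.Simple, h.choose α
  else 0

/-- The multisets of positive roots with sum `β`. -/
def kostantSet (β : E) : Set (Multiset E) :=
  {m | (∀ x ∈ m, x ∈ rs.RPos) ∧ m.sum = β}

/-- The `t`-analogue `P_t(β) = Σ_m t^{|m|}` of the Kostant partition function, summing over
all multisets `m` of positive roots with sum `β` (this set is always finite). -/
noncomputable def Pt (β : E) : Polynomial ℤ :=
  if h : (rs.kostantSet β).Finite then ∑ m ∈ h.toFinset, Polynomial.X ^ (Multiset.card m)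
  else 0

/-- `g` is the reflection in a simple root. -/
def IsSimpleReflection (g : E ≃ₗ[ℝ] E) : Prop :=
  ∃ α ∈ rs.Simple, ∀ x : E, g x = x - pairCo α x • α

/-- The Weyl group `W`, generated by the simple reflections. -/
def Weyl : Subgroup (E ≃ₗ[ℝ] E) := Subgroup.closure {g | rs.IsSimpleReflection g}

/-- The length `ℓ(w)`: the least number of simple reflections whose product is `w`. -/
noncomputable def len (g : E ≃ₗ[ℝ] E) : ℕ :=
  sInf {k | ∃ l : List (E ≃ₗ[ℝ] E),
    (∀ u ∈ l, rs.IsSimpleReflection u) ∧ l.length = k ∧ l.prod = g}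

/-- Lusztig's `t`-analogue of weight multiplicity (the Kostka–Foulkes polynomial):
`K_{λ,μ}(t) = Σ_{w ∈ W} (-1)^{ℓ(w)} P_t(w(λ+ρ) - (μ+ρ))` (the Weyl group is finite). -/
noncomputable def KF (lam mu : E) : Polynomial ℤ :=
  if h : (rs.Weyl : Set (E ≃ₗ[ℝ] E)).Finite then
    ∑ w ∈ h.toFinset, ((-1 : ℤ) ^ rs.len w) • rs.Pt (w (lam + rs.rho) - (mu + rs.rho))
  else 0

/-- The `t`-deformed dominant part of the character, `χ_λ⁺(t) = Σ_{μ ≤ λ} K_{λ,μ}(t) e^μ`,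
as a (finitely supported) function of the dominant weight `μ`. -/
noncomputable def chiPlus (lam : E) : E → Polynomial ℤ := fun ν =>
  if ν ∈ rs.Pplus ∧ rs.domLE ν lam then rs.KF lam ν else 0

/-- The `t`-deformed layer sum polynomial `w_μ⁺(t) = Σ_{ν ≤ μ} t^{⟨μ-ν,ρ^∨⟩} e^ν`,
as a function of the dominant weight `ν`. -/
noncomputable def wPlus (μ : E) : E → Polynomial ℤ := fun ν =>
  if ν ∈ rs.Pplus ∧ rs.domLE ν μ then Polynomial.X ^ rs.htRho (μ - ν) else 0

/-- `K̃_{λ,μ}(t) = t^{⟨λ-μ,ρ^∨⟩} K_{λ,μ}(t⁻¹)`. -/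
noncomputable def KFtilde (lam mu : E) : Polynomial ℤ :=
  (rs.KF lam mu).reflect (rs.htRho (lam - mu))


/-- The evaluated Weyl character
`χ_λ(F) = (Σ_{w ∈ W} (-1)^{ℓ(w)} F(w(λ+ρ) - ρ)) / ∏_{α ∈ R⁺} (1 - F(α)⁻¹)`
for a multiplicative evaluation `F` of the weights (the Weyl group is finite). -/
noncomputable def chiEval (F : E → ℝ) (lam : E) : ℝ :=
  (if h : (rs.Weyl : Set (E ≃ₗ[ℝ] E)).Finite then
      ∑ w ∈ h.toFinset, (-1 : ℝ) ^ rs.len w * F (w (lam + rs.rho) - rs.rho)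
    else 0) / ∏ α ∈ rs.RPos, (1 - (F α)⁻¹)

/-- `P(λ)`: the set of weights `γ ∈ P` whose dominant `W`-conjugate is `≤ λ` in the dominance
order (i.e. the set of weights of `V(λ)`). -/
def weightSet (lam : E) : Set E :=
  {γ | γ ∈ rs.wtLattice ∧ ∃ w ∈ rs.Weyl, w γ ∈ rs.Pplus ∧ rs.domLE (w γ) lam}

/-- The evaluated layer sum `w_λ(F) = Σ_{γ ∈ P(λ)} F(γ)` (the set `P(λ)` is finite). -/
noncomputable def wEval (F : E → ℝ) (lam : E) : ℝ :=
  if h : (rs.weightSet lam).Finite then ∑ γ ∈ h.toFinset, F γ else 0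

end RootSystemData

open RootSystemData

open Filter Topology

theorem hasSum_prod_pow_geometric {ι : Type*} [Fintype ι] (r : ι → ℝ)
    (h0 : ∀ i, 0 ≤ r i) (h1 : ∀ i, r i < 1) :
    HasSum (fun c : ι → ℕ => ∏ i, r i ^ c i) (∏ i, (1 - r i)⁻¹) := by
  revert r
  refine Fintype.induction_empty_option (P := fun ι _ => ∀ r : ι → ℝ, (∀ i, 0 ≤ r i) →
    (∀ i, r i < 1) → HasSum (fun c : ι → ℕ => ∏ i, r i ^ c i) (∏ i, (1 - r i)⁻¹)) ?_ ?_ ?_ ι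
  · intro α β _ e ih r h0 h1
    let _ := Fintype.ofEquiv β e.symm
    have h := ih (r ∘ e) (fun i => h0 _) (fun i => h1 _)
    rw [← (Equiv.arrowCongr e (Equiv.refl ℕ)).hasSum_iff, ← e.prod_comp]
    convert h using 2 with c
    · rw [Function.comp_apply, ← e.prod_comp]
      simp
    · rfl
  · intro r _ _
    simp
  · intro α _ ih r h0 h1
    have h := ih (fun i => r (some i)) (fun i => h0 _) (fun i => h1 _)
    have hg := hasSum_geometric_of_lt_one (h0 none) (h1 none)
    have hs := hg.summable.mul_of_nonneg h.summable
      (fun n => pow_nonneg (h0 none) n)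
      (fun c => Finset.prod_nonneg fun i _ => pow_nonneg (h0 _) _)
    have hm := hg.mul h hs
    rw [← (Equiv.piOptionEquivProd (β := fun _ : Option α => ℕ)).symm.hasSum_iff,
      Fintype.prod_option]
    have hfun : (fun c : Option α → ℕ => ∏ i, r i ^ c i) ∘
        (Equiv.piOptionEquivProd (β := fun _ : Option α => ℕ)).symm =
        fun x => r none ^ x.1 * ∏ i, r (some i) ^ x.2 i := by
      funext c
      simp [Fintype.prod_option, Equiv.piOptionEquivProd]
    rwa [hfun]

namespace RootSystemData

section Pairing

variable {E : Type*} [NormedAddCommGroup E] [InnerProductSpace ℝ E]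

theorem pairCo_add (α x y : E) : pairCo α (x + y) = pairCo α x + pairCo α y := by
  simp only [pairCo, inner_add_left]; ring

theorem pairCo_sub (α x y : E) : pairCo α (x - y) = pairCo α x - pairCo α y := by
  simp only [pairCo, inner_sub_left]; ring

theorem pairCo_neg (α x : E) : pairCo α (-x) = -pairCo α x := by
  simp only [pairCo, inner_neg_left]; ring

theorem pairCo_smul (α x : E) (t : ℝ) : pairCo α (t • x) = t * pairCo α x := by
  simp only [pairCo, inner_smul_left, conj_trivial]; ring

theorem pairCo_self {α : E} (h : α ≠ 0) : pairCo α α = 2 := by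
  have : ⟪α, α⟫ ≠ 0 := inner_self_ne_zero.2 h
  rw [pairCo, mul_div_assoc, div_self this, mul_one]

theorem pairCo_smul_left_smul (α x : E) {t : ℝ} (ht : t ≠ 0) :
    pairCo (t • α) x • t • α = pairCo α x • α := by
  rcases eq_or_ne α 0 with rfl | hα
  · simp
  have : ⟪α, α⟫ ≠ 0 := inner_self_ne_zero.2 hα
  rw [smul_smul]
  congr 1
  simp only [pairCo, inner_smul_left, inner_smul_right, conj_trivial]
  field_simp

end Pairing

variable {E : Type*} [NormedAddCommGroup E] [InnerProductSpace ℝ E] (rs : RootSystemData E)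

/-- The nonnegative integer combinations of simple roots. -/
def posCone : AddSubmonoid E where
  carrier := {x | ∃ c : E → ℕ, x = ∑ α ∈ rs.Simple, (c α : ℝ) • α}
  zero_mem' := ⟨0, by simp⟩
  add_mem' := by
    rintro _ _ ⟨c, rfl⟩ ⟨d, rfl⟩
    exact ⟨c + d, by simp [add_smul, Finset.sum_add_distrib]⟩

/-- The weight lattice as an additive subgroup. -/
def wtSubgroup : AddSubgroup E where
  carrier := rs.wtLattice
  zero_mem' := fun α _ => ⟨0, by simp [pairCo]⟩
  add_mem' := by
    intro x y hx hy α hα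
    obtain ⟨m, hm⟩ := hx α hα
    obtain ⟨n, hn⟩ := hy α hα
    exact ⟨m + n, by rw [pairCo_add, hm, hn]; push_cast; rfl⟩
  neg_mem' := by
    intro x hx α hα
    obtain ⟨m, hm⟩ := hx α hα
    exact ⟨-m, by rw [pairCo_neg, hm]; push_cast; rfl⟩

variable {rs}

theorem domLE_iff {ν μ : E} : rs.domLE ν μ ↔ μ - ν ∈ rs.posCone := Iff.rfl

theorem mem_posCone_of_mem_RPos {α : E} (h : α ∈ rs.RPos) : α ∈ rs.posCone :=
  rs.pos_nat_comb α h

theorem mem_wtSubgroup_of_mem_RPos {α : E} (h : α ∈ rs.RPos) : α ∈ rs.wtSubgroup :=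
  fun β hβ => rs.crystallographic α h β hβ

theorem intCast_smul_mem_wtSubgroup {x : E} (h : x ∈ rs.wtSubgroup) {r : ℝ}
    (hr : ∃ m : ℤ, r = m) : r • x ∈ rs.wtSubgroup := by
  obtain ⟨m, rfl⟩ := hr
  rw [Int.cast_smul_eq_zsmul]
  exact zsmul_mem h m

theorem posCone_le_wtSubgroup : rs.posCone ≤ rs.wtSubgroup.toAddSubmonoid := by
  rintro _ ⟨c, rfl⟩
  refine sum_mem fun α hα => ?_
  exact intCast_smul_mem_wtSubgroup (mem_wtSubgroup_of_mem_RPos (rs.simple_subset hα))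
    ⟨c α, by simp⟩

theorem coeff_eq_zero {f : E → ℝ} (h : ∑ α ∈ rs.Simple, f α • α = 0) {α : E}
    (hα : α ∈ rs.Simple) : f α = 0 := by
  have h1 : LinearIndepOn ℝ id (rs.Simple : Set E) := rs.simple_indep
  exact linearIndepOn_finset_iff.1 h1 f h α hα

theorem eq_zero_of_mem_posCone_of_neg_mem {x : E} (h : x ∈ rs.posCone) (h' : -x ∈ rs.posCone) :
    x = 0 := by
  obtain ⟨c, hc⟩ := h
  obtain ⟨d, hd⟩ := h'
  have h0 : ∑ α ∈ rs.Simple, ((c α : ℝ) + d α) • α = 0 := by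
    simp only [add_smul, Finset.sum_add_distrib]
    rw [← hc, ← hd]; simp
  rw [hc]
  refine Finset.sum_eq_zero fun α hα => ?_
  have h1 := coeff_eq_zero h0 hα
  have h2 : (0 : ℝ) ≤ c α := Nat.cast_nonneg _
  have h3 : (0 : ℝ) ≤ d α := Nat.cast_nonneg _
  rw [show (c α : ℝ) = 0 by linarith, zero_smul]

theorem neg_notMem_RPos {α : E} (h : α ∈ rs.RPos) : -α ∉ rs.RPos := fun h' =>
  rs.ne_zero α h (eq_zero_of_mem_posCone_of_neg_mem (mem_posCone_of_mem_RPos h)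
    (mem_posCone_of_mem_RPos h'))

/-- A positive root made negative by a simple reflection is proportional to the simple root. -/
theorem exists_eq_smul_of_neg_reflection_mem {α β : E} (hα : α ∈ rs.Simple) (hβ : β ∈ rs.RPos)
    (h : -(β - pairCo α β • α) ∈ rs.RPos) : ∃ t : ℝ, β = t • α := by
  obtain ⟨c, hc⟩ := rs.pos_nat_comb β hβ
  obtain ⟨d, hd⟩ := rs.pos_nat_comb _ h
  have h0 : ∑ γ ∈ rs.Simple, ((c γ : ℝ) + d γ - if γ = α then pairCo α β else 0) • γ = 0 := by
    simp only [add_smul, sub_smul, Finset.sum_add_distrib, Finset.sum_sub_distrib, ite_smul,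
      zero_smul, Finset.sum_ite_eq', hα, if_true]
    rw [← hc, ← hd]; abel
  refine ⟨c α, ?_⟩
  conv_lhs => rw [hc]
  refine Finset.sum_eq_single_of_mem α hα fun γ hγ hne => ?_
  have h1 := coeff_eq_zero h0 hγ
  rw [if_neg hne] at h1
  have h2 : (0 : ℝ) ≤ c γ := Nat.cast_nonneg _
  have h3 : (0 : ℝ) ≤ d γ := Nat.cast_nonneg _
  rw [show (c γ : ℝ) = 0 by linarith, zero_smul]

section Reflections

variable {g w : E ≃ₗ[ℝ] E}

theorem IsSimpleReflection.mul_self (h : rs.IsSimpleReflection g) : g * g = 1 := by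
  obtain ⟨α, hα, hg⟩ := h
  ext x
  have := pairCo_self (rs.ne_zero α (rs.simple_subset hα))
  simp only [LinearEquiv.mul_apply, LinearEquiv.coe_one, id, hg, pairCo_sub, pairCo_smul, this]
  module

theorem IsSimpleReflection.inner_map_map (h : rs.IsSimpleReflection g) (x y : E) :
    ⟪g x, g y⟫ = ⟪x, y⟫ := by
  obtain ⟨α, hα, hg⟩ := h
  have h0 : ⟪α, α⟫ ≠ 0 := inner_self_ne_zero.2 (rs.ne_zero α (rs.simple_subset hα))
  simp only [hg, pairCo, inner_sub_left, inner_sub_right, inner_smul_left, inner_smul_right,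
    conj_trivial, real_inner_comm α y]
  field_simp
  ring

theorem exists_list_of_mem_Weyl (h : w ∈ rs.Weyl) :
    ∃ l : List (E ≃ₗ[ℝ] E), (∀ u ∈ l, rs.IsSimpleReflection u) ∧ l.prod = w := by
  have h' : w ∈ (Subgroup.closure {g | rs.IsSimpleReflection g}).toSubmonoid := h
  rw [Subgroup.closure_toSubmonoid] at h'
  obtain ⟨l, hl, rfl⟩ := Submonoid.exists_list_of_mem_closure h'
  refine ⟨l, fun u hu => ?_, rfl⟩
  rcases hl u hu with h | h
  · exact h
  · rw [← inv_inv u, ← mul_eq_one_iff_eq_inv.1 (IsSimpleReflection.mul_self h)]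
    exact h

/-- A property of Weyl group elements follows from closure under left multiplication by simple
reflections. -/
theorem Weyl_induction {p : (E ≃ₗ[ℝ] E) → Prop} (hone : p 1)
    (hmul : ∀ g w, rs.IsSimpleReflection g → p w → p (g * w)) (h : w ∈ rs.Weyl) : p w := by
  obtain ⟨l, hl, rfl⟩ := exists_list_of_mem_Weyl h
  induction l with
  | nil => exact hone
  | cons a l ih =>
    rw [List.prod_cons]
    simp only [List.mem_cons, forall_eq_or_imp] at hl
    exact hmul _ _ hl.1
      (ih hl.2 (list_prod_mem fun u hu => Subgroup.subset_closure (hl.2 u hu)))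

theorem list_prod_mem_Weyl {l : List (E ≃ₗ[ℝ] E)} (hl : ∀ u ∈ l, rs.IsSimpleReflection u) :
    l.prod ∈ rs.Weyl :=
  list_prod_mem fun u hu => Subgroup.subset_closure (hl u hu)

theorem Weyl_inner_map_map (h : w ∈ rs.Weyl) : ∀ x y : E, ⟪w x, w y⟫ = ⟪x, y⟫ := by
  refine Weyl_induction (p := fun w => ∀ x y : E, ⟪w x, w y⟫ = ⟪x, y⟫) (by simp) ?_ h
  intro g w hg hw x y
  rw [LinearEquiv.mul_apply, LinearEquiv.mul_apply, hg.inner_map_map, hw]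

theorem Weyl_map_root (h : w ∈ rs.Weyl) :
    ∀ β ∈ rs.RPos, w β ∈ rs.RPos ∨ -(w β) ∈ rs.RPos := by
  refine Weyl_induction (p := fun w => ∀ β ∈ rs.RPos, w β ∈ rs.RPos ∨ -(w β) ∈ rs.RPos)
    (fun β hβ => Or.inl hβ) ?_ h
  rintro g w ⟨α, hα, hg⟩ hw β hβ
  have key : ∀ γ ∈ rs.RPos, g γ ∈ rs.RPos ∨ -(g γ) ∈ rs.RPos := fun γ hγ => by
    rw [hg]; exact rs.refl_closed α (rs.simple_subset hα) γ hγ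
  rw [LinearEquiv.mul_apply]
  rcases hw β hβ with h1 | h1
  · exact key _ h1
  · have := key _ h1
    rw [map_neg, neg_neg] at this
    exact this.symm

theorem Weyl_map_wtSubgroup (h : w ∈ rs.Weyl) : ∀ x ∈ rs.wtSubgroup, w x ∈ rs.wtSubgroup := by
  refine Weyl_induction (p := fun w => ∀ x ∈ rs.wtSubgroup, w x ∈ rs.wtSubgroup)
    (fun x hx => hx) ?_ h
  rintro g w ⟨α, hα, hg⟩ hw x hx
  have hα' := rs.simple_subset hα
  rw [LinearEquiv.mul_apply, hg]
  exact sub_mem (hw x hx) (intCast_smul_mem_wtSubgroup (mem_wtSubgroup_of_mem_RPos hα')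
    (hw x hx α hα'))

/-- The exchange condition: if `w = s₁ ⋯ sₙ` sends the simple root `β` to a negative root, then
`w s_β` is a product of `n - 1` simple reflections. -/
theorem exists_list_prod_mul_eq {s : E ≃ₗ[ℝ] E} {β : E} (hβ : β ∈ rs.Simple)
    (hs : ∀ x, s x = x - pairCo β x • β) (l : List (E ≃ₗ[ℝ] E))
    (hl : ∀ u ∈ l, rs.IsSimpleReflection u) (hneg : -(l.prod β) ∈ rs.RPos) :
    ∃ l' : List (E ≃ₗ[ℝ] E), (∀ u ∈ l', rs.IsSimpleReflection u) ∧
      l'.length + 1 = l.length ∧ l'.prod = l.prod * s := by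
  induction l with
  | nil => exact absurd hneg (neg_notMem_RPos (rs.simple_subset hβ))
  | cons a l ih =>
    simp only [List.mem_cons, forall_eq_or_imp] at hl
    obtain ⟨ha, hl⟩ := hl
    have hW := list_prod_mem_Weyl hl
    rcases Weyl_map_root hW β (rs.simple_subset hβ) with hpos | hneg'
    · refine ⟨l, hl, by simp, ?_⟩
      have haa := ha.mul_self
      obtain ⟨α, hα, hag⟩ := ha
      rw [List.prod_cons, LinearEquiv.mul_apply, hag] at hneg
      obtain ⟨t, ht⟩ := exists_eq_smul_of_neg_reflection_mem hα hpos hneg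
      have ht0 : t ≠ 0 := by
        rintro rfl
        rw [zero_smul] at ht
        exact rs.ne_zero _ hpos ht
      have hcomm : l.prod * s = a * l.prod := by
        ext x
        have h1 : pairCo β x = pairCo (l.prod β) (l.prod x) := by
          simp only [pairCo, Weyl_inner_map_map hW]
        simp only [LinearEquiv.mul_apply, hs, hag, map_sub, map_smul, h1]
        rw [ht, pairCo_smul_left_smul _ _ ht0]
      rw [List.prod_cons, mul_assoc, hcomm, ← mul_assoc, haa, one_mul]
    · obtain ⟨l', hl', hlen, hprod⟩ := ih hl hneg'
      refine ⟨a :: l', ?_, by simp [hlen], by simp [hprod, mul_assoc]⟩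
      simpa using ⟨ha, hl'⟩

/-- For dominant `μ` and `w` a product of simple reflections, `μ - wμ` is in the positive cone;
moreover, if `w ≠ 1`, this difference
dominates a multiple `⟨μ, β^∨⟩ γ` of a fixed positive root `γ`, with `β` a fixed simple root. -/
theorem sub_list_prod_mem_posCone (n : ℕ) (l : List (E ≃ₗ[ℝ] E)) (hn : l.length = n)
    (hl : ∀ u ∈ l, rs.IsSimpleReflection u) :
    (∀ μ ∈ rs.Pplus, μ - l.prod μ ∈ rs.posCone) ∧
    (l.prod ≠ 1 → ∃ β ∈ rs.Simple, ∃ γ ∈ rs.RPos, ∀ μ ∈ rs.Pplus,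
      μ - l.prod μ - pairCo β μ • γ ∈ rs.posCone) := by
  induction n using Nat.strong_induction_on generalizing l with
  | _ n ih =>
  rcases List.eq_nil_or_concat l with rfl | ⟨l, s, rfl⟩
  · simp [zero_mem]
  rw [List.concat_eq_append] at *
  have hlen : l.length + 1 = n := by simpa using hn
  have hl' : ∀ u ∈ l, rs.IsSimpleReflection u := fun u hu => hl u (by simp [hu])
  obtain ⟨β, hβ, hs⟩ := hl s (by simp)
  have hp : (l ++ [s]).prod = l.prod * s := by simp
  rcases Weyl_map_root (list_prod_mem_Weyl hl') β (rs.simple_subset hβ) with hpos | hneg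
  · have key : ∀ μ ∈ rs.Pplus, μ - (l ++ [s]).prod μ - pairCo β μ • l.prod β ∈ rs.posCone := by
      intro μ hμ
      have h := (ih l.length (by omega) l rfl hl').1 μ hμ
      rw [hp, LinearEquiv.mul_apply, hs, map_sub, map_smul]
      convert h using 1
      abel
    refine ⟨fun μ hμ => ?_, fun _ => ⟨β, hβ, _, hpos, key⟩⟩
    obtain ⟨m, hm⟩ := hμ.1 β (rs.simple_subset hβ)
    have h0 := hμ.2 β hβ
    have hmem : pairCo β μ • l.prod β ∈ rs.posCone := by
      rw [hm] at h0 ⊢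
      lift m to ℕ using (by exact_mod_cast h0)
      rw [Int.cast_natCast, Nat.cast_smul_eq_nsmul]
      exact nsmul_mem (mem_posCone_of_mem_RPos hpos) m
    simpa using add_mem (key μ hμ) hmem
  · obtain ⟨l'', h1, h2, h3⟩ := exists_list_prod_mul_eq hβ hs l hl' hneg
    rw [hp, ← h3]
    exact ih l''.length (by omega) l'' rfl h1

theorem sub_Weyl_mem_posCone (h : w ∈ rs.Weyl) {μ : E} (hμ : μ ∈ rs.Pplus) :
    μ - w μ ∈ rs.posCone := by
  obtain ⟨l, hl, rfl⟩ := exists_list_of_mem_Weyl h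
  exact (sub_list_prod_mem_posCone _ l rfl hl).1 μ hμ

theorem exists_root_sub_Weyl_mem_posCone (h : w ∈ rs.Weyl) (h1 : w ≠ 1) :
    ∃ β ∈ rs.Simple, ∃ γ ∈ rs.RPos, ∀ μ ∈ rs.Pplus,
      μ - w μ - pairCo β μ • γ ∈ rs.posCone := by
  obtain ⟨l, hl, rfl⟩ := exists_list_of_mem_Weyl h
  exact (sub_list_prod_mem_posCone _ l rfl hl).2 h1

theorem len_one : rs.len 1 = 0 := by
  rw [len, Nat.sInf_eq_zero]
  exact Or.inl ⟨[], by simp⟩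

theorem finite_Weyl : (rs.Weyl : Set (E ≃ₗ[ℝ] E)).Finite := by
  let T : Set E := {x | x ∈ rs.RPos ∨ -x ∈ rs.RPos}
  have hT : T.Finite := by
    refine (rs.RPos.finite_toSet.union rs.RPos.finite_toSet.neg).subset ?_
    rintro x (hx | hx)
    · exact Or.inl hx
    · exact Or.inr hx
  have : Finite T := hT
  let f : rs.Weyl → (rs.RPos → T) := fun w β => ⟨w.1 β, Weyl_map_root w.2 β β.2⟩
  have hf : Function.Injective f := by
    intro w w' h
    refine Subtype.ext (LinearEquiv.toLinearMap_injective ?_)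
    refine LinearMap.ext_on rs.span_top fun β hβ => ?_
    have := congrFun h ⟨β, hβ⟩
    simpa [f] using this
  exact Set.finite_coe_iff.1 (Finite.of_injective f hf)

theorem rho_sub_mem_wtSubgroup (h : w ∈ rs.Weyl) : w rs.rho - rs.rho ∈ rs.wtSubgroup := by
  refine Weyl_induction (p := fun w => w rs.rho - rs.rho ∈ rs.wtSubgroup)
    (by simp [zero_mem]) ?_ h
  intro g w hg hw
  have hgW : g ∈ rs.Weyl := Subgroup.subset_closure hg
  have hgg := hg.mul_self
  obtain ⟨α, hα, hgα⟩ := id hg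
  have hα0 := rs.ne_zero α (rs.simple_subset hα)
  have hsimple : g rs.rho - rs.rho ∈ rs.wtSubgroup := by
    let p : E → Prop := fun β => ∃ t : ℝ, β = t • α
    have hA : ∑ β ∈ rs.RPos with ¬ p β, g β = ∑ β ∈ rs.RPos with ¬ p β, β := by
      have hinv : ∀ β, g (g β) = β := fun β => by
        rw [← LinearEquiv.mul_apply, hgg]; rfl
      have hmem : ∀ β ∈ rs.RPos.filter (fun β => ¬ p β), g β ∈ rs.RPos.filter (fun β => ¬ p β) := by
        intro β hβ
        rw [Finset.mem_filter] at hβ ⊢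
        refine ⟨?_, ?_⟩
        · rcases Weyl_map_root hgW β hβ.1 with h1 | h1
          · exact h1
          · rw [hgα] at h1
            exact absurd (exists_eq_smul_of_neg_reflection_mem hα hβ.1 h1) hβ.2
        · rintro ⟨t, ht⟩
          refine hβ.2 ⟨t - 2 * t, ?_⟩
          rw [← hinv β, ht, hgα, pairCo_smul, pairCo_self hα0]
          module
      exact Finset.sum_bij' (fun β _ => g β) (fun β _ => g β) hmem hmem
        (fun β _ => hinv β) (fun β _ => hinv β) (fun β _ => rfl)
    have hB : ∑ β ∈ rs.RPos with p β, g β = - ∑ β ∈ rs.RPos with p β, β := by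
      rw [← Finset.sum_neg_distrib]
      refine Finset.sum_congr rfl fun β hβ => ?_
      obtain ⟨t, rfl⟩ := (Finset.mem_filter.1 hβ).2
      rw [hgα, pairCo_smul, pairCo_self hα0]
      module
    have : g rs.rho - rs.rho = - ∑ β ∈ rs.RPos with p β, β := by
      rw [rho, map_smul, map_sum, ← Finset.sum_filter_add_sum_filter_not rs.RPos p, hA, hB,
        ← Finset.sum_filter_add_sum_filter_not rs.RPos p (fun β => β)]
      module
    rw [this]
    exact neg_mem (sum_mem fun β hβ => mem_wtSubgroup_of_mem_RPos (Finset.mem_filter.1 hβ).1)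
  have h1 := add_mem (Weyl_map_wtSubgroup hgW _ hw) hsimple
  rw [map_sub] at h1
  simpa using h1

end Reflections

theorem finite_wtLattice_inter_ball (C : ℝ) : {x ∈ rs.wtLattice | ‖x‖ ≤ C}.Finite := by
  have hex : ∀ x : {x ∈ rs.wtLattice | ‖x‖ ≤ C}, ∀ α : rs.RPos, ∃ m : ℤ,
      pairCo (α : E) (x : E) = m := fun x α => x.2.1 α α.2
  choose f hf using hex
  have hb : ∀ x α, |f x α| ≤ ⌈2 * C / ‖(α : E)‖⌉ := by
    intro x α
    have hα : 0 < ‖(α : E)‖ := norm_pos_iff.2 (rs.ne_zero α α.2)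
    have : (|f x α| : ℝ) ≤ 2 * C / ‖(α : E)‖ := by
      rw [← hf, pairCo, real_inner_self_eq_norm_sq, abs_div, abs_mul, abs_two,
        abs_of_pos (pow_pos hα 2), div_le_div_iff₀ (pow_pos hα 2) hα]
      have h1 := abs_real_inner_le_norm (x : E) (α : E)
      have h2 := mul_le_mul_of_nonneg_right x.2.2 hα.le
      nlinarith
    exact_mod_cast this.trans (Int.le_ceil _)
  have hinj : Function.Injective f := by
    intro x y hxy
    refine Subtype.ext (sub_eq_zero.1 ?_)
    have horth : ∀ z ∈ Submodule.span ℝ (rs.RPos : Set E), ⟪(x : E) - y, z⟫ = 0 := by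
      intro z hz
      induction hz using Submodule.span_induction with
      | mem α hα =>
        have h1 := hf x ⟨α, hα⟩
        rw [hxy, ← hf y, ← sub_eq_zero, ← pairCo_sub, pairCo, div_eq_zero_iff] at h1
        rcases h1 with h1 | h1
        · simpa using h1
        · exact absurd (inner_self_eq_zero.1 h1) (rs.ne_zero α hα)
      | zero => simp
      | add a b _ _ ha hb => rw [inner_add_right, ha, hb, add_zero]
      | smul t a _ ha => rw [inner_smul_right, ha, mul_zero]
    have := horth ((x : E) - y) (by rw [rs.span_top]; trivial)
    exact inner_self_eq_zero.1 this
  have hfin : (Set.univ.pi fun α : rs.RPos =>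
      Set.Icc (-⌈2 * C / ‖(α : E)‖⌉) ⌈2 * C / ‖(α : E)‖⌉).Finite :=
    Set.Finite.pi' (fun α => Set.finite_Icc _ _) |>.subset (by intro g hg α; exact hg α trivial)
  have : Finite {x ∈ rs.wtLattice | ‖x‖ ≤ C} := by
    have := hfin.preimage hinj.injOn
    refine Set.finite_univ_iff.1 (this.subset fun x _ α _ => ?_)
    exact abs_le.1 (hb x α)
  exact Set.toFinite _

theorem inner_nonneg_of_posCone_of_dominant {x μ : E} (hx : x ∈ rs.posCone) (hμ : μ ∈ rs.Pplus) :
    0 ≤ ⟪x, μ⟫ := by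
  obtain ⟨c, rfl⟩ := hx
  rw [sum_inner]
  refine Finset.sum_nonneg fun α hα => ?_
  rw [inner_smul_left, conj_trivial]
  refine mul_nonneg (Nat.cast_nonneg _) ?_
  have h0 : 0 < ⟪α, α⟫ := real_inner_self_pos.2 (rs.ne_zero α (rs.simple_subset hα))
  have h1 := hμ.2 α hα
  rw [pairCo, le_div_iff₀ h0] at h1
  linarith [real_inner_comm α μ]

theorem finite_weightSet {lam : E} (hlam : lam ∈ rs.Pplus) : (rs.weightSet lam).Finite := by
  refine (finite_wtLattice_inter_ball (rs := rs) ‖lam‖).subset ?_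
  rintro γ ⟨hγ, w, hw, hdom, hle⟩
  refine ⟨hγ, ?_⟩
  have h1 : ⟪γ, γ⟫ = ⟪w γ, w γ⟫ := (Weyl_inner_map_map hw γ γ).symm
  have h2 := inner_nonneg_of_posCone_of_dominant (domLE_iff.1 hle) hdom
  have h3 := inner_nonneg_of_posCone_of_dominant (domLE_iff.1 hle) hlam
  rw [inner_sub_left] at h2 h3
  rw [← abs_of_nonneg (norm_nonneg γ), ← abs_of_nonneg (norm_nonneg lam), ← sq_le_sq,
    ← real_inner_self_eq_norm_sq, ← real_inner_self_eq_norm_sq, h1]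
  have := real_inner_comm lam (w γ)
  linarith

theorem sub_mem_posCone_of_mem_weightSet {lam γ : E} (h : γ ∈ rs.weightSet lam) :
    lam - γ ∈ rs.posCone := by
  obtain ⟨hγ, w, hw, hdom, hle⟩ := h
  have h1 := sub_Weyl_mem_posCone (inv_mem hw) hdom
  have h2 : w⁻¹ (w γ) = γ := by rw [← LinearEquiv.mul_apply, inv_mul_cancel]; rfl
  rw [h2] at h1
  simpa using add_mem (domLE_iff.1 hle) h1

/-- The combination of simple roots with coefficients `c`. -/
noncomputable def simpleComb (rs : RootSystemData E) (c : rs.Simple → ℕ) : E :=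
  ∑ α, (c α : ℝ) • (α : E)

theorem mem_posCone_iff {x : E} : x ∈ rs.posCone ↔ ∃ c, rs.simpleComb c = x := by
  constructor
  · rintro ⟨c, rfl⟩
    exact ⟨fun α => c α, Finset.sum_coe_sort rs.Simple (fun α => (c α : ℝ) • α)⟩
  · rintro ⟨c, rfl⟩
    refine sum_mem fun α _ => ?_
    rw [Nat.cast_smul_eq_nsmul]
    exact nsmul_mem (mem_posCone_of_mem_RPos (rs.simple_subset α.2)) _

theorem simpleComb_injective : Function.Injective rs.simpleComb := by
  intro c d h
  funext α
  have h1 := Fintype.linearIndependent_iff.1 rs.simple_indep (fun α => (c α : ℝ) - d α) (by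
    simp only [sub_smul, Finset.sum_sub_distrib]
    exact sub_eq_zero.2 h) α
  exact_mod_cast sub_eq_zero.1 h1

section Evaluation

variable {F : E → ℝ} (hFpos : ∀ x, 0 < F x)
  (hFhom : ∀ x ∈ rs.wtLattice, ∀ y ∈ rs.wtLattice, F (x + y) = F x * F y)
include hFpos hFhom

theorem eval_zero : F 0 = 1 := by
  have h := hFhom 0 rs.wtSubgroup.zero_mem 0 rs.wtSubgroup.zero_mem
  rw [add_zero] at h
  have := hFpos 0
  exact (mul_right_cancel₀ this.ne' (by rw [one_mul]; exact h)).symm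

theorem eval_sub {x y : E} (hx : x ∈ rs.wtSubgroup) (hy : y ∈ rs.wtSubgroup) :
    F (x - y) = F x * (F y)⁻¹ := by
  have h := hFhom (x - y) (sub_mem hx hy) y hy
  rw [sub_add_cancel] at h
  rw [h, mul_assoc, mul_inv_cancel₀ (hFpos y).ne', mul_one]

theorem eval_nsmul {x : E} (hx : x ∈ rs.wtSubgroup) (n : ℕ) : F (n • x) = F x ^ n := by
  induction n with
  | zero => simp [eval_zero hFpos hFhom]
  | succ n ih => rw [succ_nsmul, hFhom _ (nsmul_mem hx n) _ hx, ih, pow_succ]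

theorem eval_simpleComb (c : rs.Simple → ℕ) : F (rs.simpleComb c) = ∏ α : rs.Simple, F (α : E) ^ c α := by
  have hmem : ∀ α : rs.Simple, (c α) • (α : E) ∈ rs.wtSubgroup := fun α =>
    nsmul_mem (mem_wtSubgroup_of_mem_RPos (rs.simple_subset α.2)) _
  have key : ∀ s : Finset rs.Simple,
      F (∑ α ∈ s, (c α) • (α : E)) = ∏ α ∈ s, F (α : E) ^ c α := by
    intro s
    induction s using Finset.induction_on with
    | empty => simpa using eval_zero hFpos hFhom
    | insert a s ha ih =>
      rw [Finset.sum_insert ha, Finset.prod_insert ha,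
        hFhom _ (hmem a) _ (sum_mem (S := rs.wtSubgroup) fun α _ => hmem α), ih,
        eval_nsmul hFpos hFhom (mem_wtSubgroup_of_mem_RPos (rs.simple_subset a.2))]
  rw [← key]
  simp only [simpleComb, Nat.cast_smul_eq_nsmul]

variable (hFgt : ∀ α ∈ rs.Simple, 1 < F α)
include hFgt

theorem one_le_eval_of_mem_posCone {x : E} (hx : x ∈ rs.posCone) : 1 ≤ F x := by
  obtain ⟨c, rfl⟩ := mem_posCone_iff.1 hx
  rw [eval_simpleComb hFpos hFhom]
  exact Finset.prod_induction _ (1 ≤ ·) (fun _ _ => one_le_mul_of_one_le_of_one_le) le_rfl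
    fun α _ => one_le_pow₀ (hFgt α α.2).le

theorem one_lt_eval_of_mem_RPos {γ : E} (hγ : γ ∈ rs.RPos) : 1 < F γ := by
  obtain ⟨c, rfl⟩ := mem_posCone_iff.1 (mem_posCone_of_mem_RPos hγ)
  have hne : ∃ α, c α ≠ 0 := by
    by_contra! h
    exact rs.ne_zero _ hγ (by simp [simpleComb, h])
  obtain ⟨α, hα⟩ := hne
  rw [eval_simpleComb hFpos hFhom, ← Finset.mul_prod_erase _ _ (Finset.mem_univ α)]
  refine lt_of_lt_of_le (one_lt_pow₀ (hFgt α α.2) hα) ?_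
  refine le_mul_of_one_le_right (pow_pos (hFpos _) _).le ?_
  exact Finset.prod_induction _ (1 ≤ ·) (fun _ _ => one_le_mul_of_one_le_of_one_le) le_rfl
    fun β _ => one_le_pow₀ (hFgt β β.2).le

variable {lamSeq : ℕ → E} (hdom : ∀ k, lamSeq k ∈ rs.Pplus)
  (hlim : ∀ α ∈ rs.Simple, Tendsto (fun k => pairCo α (lamSeq k)) atTop atTop)
include hdom hlim

theorem tendsto_eval_sub_Weyl {w : E ≃ₗ[ℝ] E} (hw : w ∈ rs.Weyl) (h1 : w ≠ 1) :
    Tendsto (fun k => F (lamSeq k - w (lamSeq k))) atTop atTop := by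
  obtain ⟨β, hβ, γ, hγ, h⟩ := exists_root_sub_Weyl_mem_posCone hw h1
  have hpow := (tendsto_pow_atTop_atTop_of_one_lt
    (one_lt_eval_of_mem_RPos hFpos hFhom hFgt hγ)).comp
    (tendsto_nat_floor_atTop.comp (hlim β hβ))
  refine tendsto_atTop_mono (fun k => ?_) hpow
  have hk := hdom k
  have hγP := mem_wtSubgroup_of_mem_RPos hγ
  have hq := h _ hk
  obtain ⟨m, hm⟩ := hk.1 β (rs.simple_subset hβ)
  have h0 := hk.2 β hβ
  rw [hm] at h0
  lift m to ℕ using (by exact_mod_cast h0)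
  rw [Int.cast_natCast] at hm
  rw [hm, Nat.cast_smul_eq_nsmul] at hq
  simp only [Function.comp_apply, hm, Nat.floor_natCast]
  rw [← eval_nsmul hFpos hFhom hγP,
    ← sub_add_cancel (lamSeq k - w (lamSeq k)) (m • γ),
    hFhom _ (posCone_le_wtSubgroup hq) _ (nsmul_mem hγP m)]
  exact le_mul_of_one_le_left (hFpos _).le (one_le_eval_of_mem_posCone hFpos hFhom hFgt hq)

theorem tendsto_inv_mul_chiEval :
    Tendsto (fun k => (F (lamSeq k))⁻¹ * rs.chiEval F (lamSeq k)) atTop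
      (𝓝 (∏ α ∈ rs.RPos, (1 - (F α)⁻¹)⁻¹)) := by
  have hterm : ∀ w ∈ (finite_Weyl (rs := rs)).toFinset,
      Tendsto (fun k => (F (lamSeq k))⁻¹ *
        ((-1 : ℝ) ^ rs.len w * F (w (lamSeq k + rs.rho) - rs.rho))) atTop
        (𝓝 (if w = 1 then 1 else 0)) := by
    intro w hw
    rw [Set.Finite.mem_toFinset, SetLike.mem_coe] at hw
    split_ifs with h1
    · subst h1
      refine tendsto_const_nhds.congr fun k => ?_
      simp [len_one, (hFpos (lamSeq k)).ne']
    · have h := (tendsto_eval_sub_Weyl hFpos hFhom hFgt hdom hlim hw h1).inv_tendsto_atTop.const_mul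
        ((-1 : ℝ) ^ rs.len w * F (w rs.rho - rs.rho))
      rw [mul_zero] at h
      refine h.congr fun k => ?_
      have hk : lamSeq k ∈ rs.wtSubgroup := (hdom k).1
      have hwk := Weyl_map_wtSubgroup hw _ hk
      rw [map_add, add_sub_assoc, hFhom _ hwk _ (rho_sub_mem_wtSubgroup hw), Pi.inv_apply,
        eval_sub hFpos hFhom hk hwk, mul_inv, inv_inv]
      ring
  have hsum := (tendsto_finsetSum _ hterm).div_const (∏ α ∈ rs.RPos, (1 - (F α)⁻¹))
  have hone : (1 : E ≃ₗ[ℝ] E) ∈ (finite_Weyl (rs := rs)).toFinset := by simp [one_mem]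
  rw [Finset.sum_ite_eq' _ _ _, if_pos hone, one_div, ← Finset.prod_inv_distrib] at hsum
  refine hsum.congr fun k => ?_
  rw [chiEval, dif_pos finite_Weyl, ← mul_div_assoc, Finset.mul_sum]

omit hFgt hdom hlim in
theorem inv_mul_wEval_eq_tsum {lam : E} (hlam : lam ∈ rs.Pplus) :
    (F lam)⁻¹ * rs.wEval F lam = ∑' c : rs.Simple → ℕ,
      if lam - rs.simpleComb c ∈ rs.weightSet lam then ∏ α : rs.Simple, ((F α)⁻¹) ^ c α else 0 := by
  have hfin := finite_weightSet hlam
  have hinj : Function.Injective fun c => lam - rs.simpleComb c := fun c d h =>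
    simpleComb_injective (sub_right_injective h)
  let f : E → ℝ := fun γ => if γ ∈ hfin.toFinset then (F lam)⁻¹ * F γ else 0
  have hsupp : Function.support f ⊆ Set.range fun c => lam - rs.simpleComb c := by
    intro γ hγ
    have hmem : γ ∈ rs.weightSet lam := by
      by_contra h
      exact hγ (by simp [f, h])
    obtain ⟨c, hc⟩ := mem_posCone_iff.1 (sub_mem_posCone_of_mem_weightSet hmem)
    exact ⟨c, by simp [hc]⟩
  have hf : ∑' γ, f γ = (F lam)⁻¹ * rs.wEval F lam := by
    rw [wEval, dif_pos hfin, Finset.mul_sum, tsum_eq_sum (s := hfin.toFinset)]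
    · exact Finset.sum_congr rfl fun γ hγ => if_pos hγ
    · exact fun γ hγ => if_neg hγ
  rw [← hf, ← hinj.tsum_eq hsupp]
  refine tsum_congr fun c => ?_
  have hc : rs.simpleComb c ∈ rs.wtSubgroup := posCone_le_wtSubgroup (mem_posCone_iff.2 ⟨c, rfl⟩)
  have hval : (F lam)⁻¹ * F (lam - rs.simpleComb c) = ∏ α : rs.Simple, ((F α)⁻¹) ^ c α := by
    rw [eval_sub hFpos hFhom hlam.1 hc, ← mul_assoc, inv_mul_cancel₀ (hFpos lam).ne', one_mul,
      eval_simpleComb hFpos hFhom, ← Finset.prod_inv_distrib]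
    simp only [inv_pow]
  simp only [f, Set.Finite.mem_toFinset, hval]

theorem tendsto_inv_mul_wEval :
    Tendsto (fun k => (F (lamSeq k))⁻¹ * rs.wEval F (lamSeq k)) atTop
      (𝓝 (∏ α ∈ rs.Simple, (1 - (F α)⁻¹)⁻¹)) := by
  have hgeom := hasSum_prod_pow_geometric (fun α : rs.Simple => (F α)⁻¹)
    (fun α => (inv_pos.2 (hFpos _)).le) (fun α => inv_lt_one_of_one_lt₀ (hFgt α α.2))
  have hnonneg : ∀ c : rs.Simple → ℕ, 0 ≤ ∏ α : rs.Simple, ((F α)⁻¹) ^ c α := fun c =>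
    Finset.prod_nonneg fun α _ => pow_nonneg (inv_pos.2 (hFpos _)).le _
  rw [← Finset.prod_coe_sort rs.Simple (fun α => (1 - (F α)⁻¹)⁻¹), ← hgeom.tsum_eq]
  simp only [fun k => inv_mul_wEval_eq_tsum hFpos hFhom (hdom k)]
  refine tendsto_tsum_of_dominated_convergence hgeom.summable (fun c => ?_)
    (Eventually.of_forall fun k c => ?_)
  · have hev : ∀ᶠ k in atTop, ∀ α ∈ rs.Simple, pairCo α (rs.simpleComb c) ≤ pairCo α (lamSeq k) :=
      (Finset.eventually_all rs.Simple).2 fun α hα => (hlim α hα).eventually_ge_atTop _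
    refine tendsto_const_nhds.congr' (hev.mono fun k hk => (if_pos ?_).symm)
    have hcone : rs.simpleComb c ∈ rs.posCone := mem_posCone_iff.2 ⟨c, rfl⟩
    have hP : lamSeq k - rs.simpleComb c ∈ rs.wtLattice :=
      rs.wtSubgroup.sub_mem (hdom k).1 (posCone_le_wtSubgroup hcone)
    refine ⟨hP, 1, one_mem _, ⟨hP, fun α hα => ?_⟩, ?_⟩
    · rw [LinearEquiv.coe_one, id, pairCo_sub]
      exact sub_nonneg.2 (hk α hα)
    · rw [domLE_iff, LinearEquiv.coe_one, id, sub_sub_cancel]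
      exact hcone
  · split_ifs
    · rw [Real.norm_of_nonneg (hnonneg c)]
    · rw [norm_zero]
      exact hnonneg c

end Evaluation

end RootSystemData

/-- Fix a group homomorphism `F : (P,+) → (ℝ_{>0},×)` with `F(α_i) > 1` for
every simple root `α_i`. Then for every sequence `(λ^{(k)})` of dominant weights with
`⟨λ^{(k)}, α_i^∨⟩ → +∞` for each simple root `α_i`, one has
`F(λ^{(k)})⁻¹ χ_{λ^{(k)}}(F) → ∏_{α ∈ R⁺} (1 - F(α)⁻¹)⁻¹` and
`F(λ^{(k)})⁻¹ w_{λ^{(k)}}(F) → ∏_{α ∈ S} (1 - F(α)⁻¹)⁻¹`. -/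
theorem statement2 {E : Type*} [NormedAddCommGroup E] [InnerProductSpace ℝ E]
    (rs : RootSystemData E) (F : E → ℝ)
    (hFpos : ∀ x, 0 < F x)
    (hFhom : ∀ x ∈ rs.wtLattice, ∀ y ∈ rs.wtLattice, F (x + y) = F x * F y)
    (hFgt : ∀ α ∈ rs.Simple, 1 < F α)
    (lamSeq : ℕ → E) (hdom : ∀ k, lamSeq k ∈ rs.Pplus)
    (hlim : ∀ α ∈ rs.Simple,
      Filter.Tendsto (fun k => pairCo α (lamSeq k)) Filter.atTop Filter.atTop) :
    Filter.Tendsto (fun k => (F (lamSeq k))⁻¹ * rs.chiEval F (lamSeq k)) Filter.atTop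
      (nhds (∏ α ∈ rs.RPos, (1 - (F α)⁻¹)⁻¹)) ∧
    Filter.Tendsto (fun k => (F (lamSeq k))⁻¹ * rs.wEval F (lamSeq k)) Filter.atTop
      (nhds (∏ α ∈ rs.Simple, (1 - (F α)⁻¹)⁻¹)) := by
  exact ⟨tendsto_inv_mul_chiEval hFpos hFhom hFgt hdom hlim,
    tendsto_inv_mul_wEval hFpos hFhom hFgt hdom hlim⟩

end AtomicPaper
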